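/- Let {ℓ_α : α ∈ A} and {ℓ'_α : α ∈ A} be two families of distinct light-like lines in R^{N+1}. There is a positive Lorentz transformation φ with φ(ℓ_α) = ℓ'_α for each α if and only if the Lorentz cross-ratios agree: |ℓ_α,ℓ_β,ℓ_γ,ℓ_δ| = |ℓ'_α,ℓ'_β,ℓ'_γ,ℓ'_δ| for all 4-tuples of distinct indices. -/

import Mathlib

/-- The Lorentz inner product on ℝ^{N+1}. -/
def lorentz {N : ℕ} (x y : Fin (N + 1) → ℝ) : ℝ :=
  (∑ i : Fin N, x i.castSucc * y i.castSucc) - x (Fin.last N) * y (Fin.last N)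

/-- A Lorentz transformation: a linear automorphism preserving the Lorentz product. -/
def IsLorentz {N : ℕ} (φ : (Fin (N + 1) → ℝ) ≃ₗ[ℝ] (Fin (N + 1) → ℝ)) : Prop :=
  ∀ x y, lorentz (φ x) (φ y) = lorentz x y

/-- A Lorentz transformation is positive if it maps positive time-like vectors to
positive time-like vectors. -/
def IsPositiveLorentz {N : ℕ} (φ : (Fin (N + 1) → ℝ) ≃ₗ[ℝ] (Fin (N + 1) → ℝ)) : Prop :=
  ∀ x : Fin (N + 1) → ℝ, lorentz x x < 0 → 0 < x (Fin.last N) → 0 < (φ x) (Fin.last N)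

section LorentzForm

variable {N : ℕ}

theorem lorentz_comm (x y : Fin (N + 1) → ℝ) : lorentz x y = lorentz y x := by
  simp only [lorentz, mul_comm]

theorem lorentz_add_left (x y z : Fin (N + 1) → ℝ) :
    lorentz (x + y) z = lorentz x z + lorentz y z := by
  simp only [lorentz, Pi.add_apply, add_mul, Finset.sum_add_distrib]
  ring

theorem lorentz_smul_left (a : ℝ) (x y : Fin (N + 1) → ℝ) :
    lorentz (a • x) y = a * lorentz x y := by
  simp only [lorentz, Pi.smul_apply, smul_eq_mul, mul_sub, Finset.mul_sum, mul_assoc]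

theorem lorentz_add_right (x y z : Fin (N + 1) → ℝ) :
    lorentz x (y + z) = lorentz x y + lorentz x z := by
  rw [lorentz_comm, lorentz_add_left, lorentz_comm y, lorentz_comm z]

theorem lorentz_smul_right (a : ℝ) (x y : Fin (N + 1) → ℝ) :
    lorentz x (a • y) = a * lorentz x y := by
  rw [lorentz_comm, lorentz_smul_left, lorentz_comm y]

theorem lorentz_sub_left (x y z : Fin (N + 1) → ℝ) :
    lorentz (x - y) z = lorentz x z - lorentz y z := by
  rw [sub_eq_add_neg, ← neg_one_smul ℝ y, lorentz_add_left, lorentz_smul_left]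
  ring

theorem lorentz_sub_right (x y z : Fin (N + 1) → ℝ) :
    lorentz x (y - z) = lorentz x y - lorentz x z := by
  rw [lorentz_comm, lorentz_sub_left, lorentz_comm y, lorentz_comm z]

theorem lorentz_single_last (x : Fin (N + 1) → ℝ) :
    lorentz x (Pi.single (Fin.last N) 1) = -x (Fin.last N) := by
  simp [lorentz]

theorem sum_mul_eq_lorentz (x y : Fin (N + 1) → ℝ) :
    ∑ i, x i * y i = lorentz x y + 2 * (x (Fin.last N) * y (Fin.last N)) := by
  rw [Fin.sum_univ_castSucc, lorentz]
  ring

theorem lorentz_self_nonneg {z : Fin (N + 1) → ℝ} (hz : z (Fin.last N) = 0) :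
    0 ≤ lorentz z z := by
  simp only [lorentz, hz, mul_zero, sub_zero]
  exact Finset.sum_nonneg fun i _ => mul_self_nonneg _

theorem eq_zero_of_lorentz_self {z : Fin (N + 1) → ℝ} (hz : z (Fin.last N) = 0)
    (h : lorentz z z = 0) : z = 0 := by
  have h' := sum_mul_eq_lorentz z z
  rw [h, hz, mul_zero, mul_zero, add_zero,
    Finset.sum_eq_zero_iff_of_nonneg fun i _ => mul_self_nonneg _] at h'
  ext i
  exact mul_self_eq_zero.1 (h' i (Finset.mem_univ i))

theorem lorentz_eq_zero_left {x : Fin (N + 1) → ℝ} (h : ∀ y, lorentz x y = 0) : x = 0 := by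
  refine eq_zero_of_lorentz_self ?_ (h x)
  have := h (Pi.single (Fin.last N) 1)
  rwa [lorentz_single_last, neg_eq_zero] at this

theorem lorentz_cross_self (x y : Fin (N + 1) → ℝ) (a b : ℝ) :
    lorentz (a • x - b • y) (a • x - b • y) =
      a ^ 2 * lorentz x x + b ^ 2 * lorentz y y - 2 * (a * b) * lorentz x y := by
  simp only [lorentz_sub_left, lorentz_sub_right, lorentz_smul_left, lorentz_smul_right,
    lorentz_comm y x]
  ring

/-- The reversed Cauchy–Schwarz inequality, in qualitative form, for time-like vectors. -/
theorem lorentz_neg_of_timelike {x y : Fin (N + 1) → ℝ} (hx : lorentz x x < 0)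
    (hy : lorentz y y < 0) (hx0 : 0 < x (Fin.last N)) (hy0 : 0 < y (Fin.last N)) :
    lorentz x y < 0 := by
  have h1 : 0 ≤ lorentz (y (Fin.last N) • x - x (Fin.last N) • y)
      (y (Fin.last N) • x - x (Fin.last N) • y) :=
    lorentz_self_nonneg (by simp [mul_comm])
  rw [lorentz_cross_self] at h1
  have h2 := mul_neg_of_pos_of_neg (pow_pos hy0 2) hx
  have h3 := mul_neg_of_pos_of_neg (pow_pos hx0 2) hy
  have h4 := mul_pos hy0 hx0
  by_contra! h5
  nlinarith [mul_nonneg h4.le h5]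

/-- Positive light-like vectors spanning distinct lines have negative Lorentz product. -/
theorem lorentz_neg_of_lightlike {x y : Fin (N + 1) → ℝ} (hx : lorentz x x = 0)
    (hy : lorentz y y = 0) (hx0 : 0 < x (Fin.last N)) (hy0 : 0 < y (Fin.last N))
    (hxy : Submodule.span ℝ {x} ≠ Submodule.span ℝ {y}) : lorentz x y < 0 := by
  have hz : (y (Fin.last N) • x - x (Fin.last N) • y) (Fin.last N) = 0 := by simp [mul_comm]
  have h1 := lorentz_self_nonneg hz
  have h2 := fun h => eq_zero_of_lorentz_self hz h
  rw [lorentz_cross_self, hx, hy] at h1 h2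
  have h4 := mul_pos hy0 hx0
  by_contra! h5
  refine hxy ?_
  have h6 := sub_eq_zero.1 (h2 (le_antisymm (by nlinarith [mul_nonneg h4.le h5]) h1))
  rw [← Submodule.span_singleton_smul_eq (IsUnit.mk0 _ hy0.ne') x, h6,
    Submodule.span_singleton_smul_eq (IsUnit.mk0 _ hx0.ne')]

end LorentzForm

section LorentzMaps

variable {N : ℕ}

/-- The Lorentz transformation given by a linear map preserving the Lorentz product. -/
theorem exists_linearEquiv_of_lorentz (f : (Fin (N + 1) → ℝ) →ₗ[ℝ] (Fin (N + 1) → ℝ))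
    (hf : ∀ x y, lorentz (f x) (f y) = lorentz x y) :
    ∃ φ : (Fin (N + 1) → ℝ) ≃ₗ[ℝ] (Fin (N + 1) → ℝ), IsLorentz φ ∧ ∀ x, φ x = f x := by
  have hinj : Function.Injective f := by
    refine (injective_iff_map_eq_zero f).2 fun x hx => lorentz_eq_zero_left fun y => ?_
    rw [← hf, hx, ← zero_smul ℝ (0 : Fin (N + 1) → ℝ), lorentz_smul_left, zero_mul]
  exact ⟨LinearEquiv.ofInjectiveEndo f hinj, hf, fun _ => rfl⟩

/-- A Lorentz transformation is positive as soon as it maps one positive time-like vector to a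
positive vector. -/
theorem IsLorentz.isPositive {φ : (Fin (N + 1) → ℝ) ≃ₗ[ℝ] (Fin (N + 1) → ℝ)} (hφ : IsLorentz φ)
    {t : Fin (N + 1) → ℝ} (ht : lorentz t t < 0) (ht0 : 0 < t (Fin.last N))
    (hφt : 0 < φ t (Fin.last N)) : IsPositiveLorentz φ := by
  intro x hx hx0
  by_contra! h
  have hxt := lorentz_neg_of_timelike hx ht hx0 ht0
  rw [← hφ] at hx ht hxt
  rcases h.lt_or_eq with h | h
  · have := lorentz_neg_of_timelike (x := (-1 : ℝ) • φ x) (y := φ t)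
      (by simpa only [lorentz_smul_left, lorentz_smul_right, neg_one_mul, neg_neg] using hx) ht
      (by simpa using h) hφt
    rw [lorentz_smul_left] at this
    linarith
  · exact absurd (lorentz_self_nonneg h) (not_le.2 hx)

/-- A time-like vector is moved to the time axis by a Lorentz involution. -/
theorem exists_lorentz_involution {t : Fin (N + 1) → ℝ} {c : ℝ} (hc : 0 < c)
    (ht : lorentz t t = -c ^ 2) :
    ∃ f : (Fin (N + 1) → ℝ) →ₗ[ℝ] (Fin (N + 1) → ℝ),
      (∀ x y, lorentz (f x) (f y) = lorentz x y) ∧ (∀ x, f (f x) = x) ∧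
        f t = c • Pi.single (Fin.last N) 1 := by
  set e : Fin (N + 1) → ℝ := Pi.single (Fin.last N) 1 with he
  set u := t - c • e with hu
  by_cases hu0 : u = 0
  · exact ⟨LinearMap.id, fun _ _ => rfl, fun _ => rfl, sub_eq_zero.1 hu0⟩
  have hee : lorentz e e = -1 := by rw [he, lorentz_single_last]; simp
  have hte : lorentz t e = -t (Fin.last N) := lorentz_single_last t
  have huu : lorentz u u = 2 * c * (t (Fin.last N) - c) := by
    simp only [hu, lorentz_sub_left, lorentz_sub_right, lorentz_smul_left, lorentz_smul_right,
      lorentz_comm e t, hee, hte, ht]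
    ring
  have htu : lorentz t u = c * (t (Fin.last N) - c) := by
    simp only [hu, lorentz_sub_right, lorentz_smul_right, hte, ht]
    ring
  have hne : lorentz u u ≠ 0 := by
    intro h
    have htc : t (Fin.last N) = c := by
      rw [huu] at h
      have : (2 * c) ≠ 0 := by positivity
      exact sub_eq_zero.1 ((mul_eq_zero.1 h).resolve_left this)
    exact hu0 (eq_zero_of_lorentz_self (by simp [hu, he, htc]) h)
  let g : (Fin (N + 1) → ℝ) →ₗ[ℝ] ℝ :=
    { toFun := fun x => lorentz x u
      map_add' := fun x y => lorentz_add_left x y u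
      map_smul' := fun a x => lorentz_smul_left a x u }
  let f : (Fin (N + 1) → ℝ) →ₗ[ℝ] (Fin (N + 1) → ℝ) :=
    LinearMap.id - (2 / lorentz u u) • g.smulRight u
  have hf : ∀ x, f x =
      x - (2 * lorentz x u / lorentz u u) • u := by
    intro x
    simp only [LinearMap.sub_apply, LinearMap.id_apply, LinearMap.smul_apply,
      LinearMap.smulRight_apply, smul_smul, f, g, LinearMap.coe_mk, AddHom.coe_mk]
    congr 2
    ring
  refine ⟨f, fun x y => ?_, fun x => ?_, ?_⟩
  · rw [hf, hf]
    simp only [lorentz_sub_left, lorentz_sub_right, lorentz_smul_left, lorentz_smul_right,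
      lorentz_comm u y]
    field_simp
    ring
  · rw [hf, hf]
    simp only [lorentz_sub_left, lorentz_smul_left]
    rw [div_mul_cancel₀ _ hne, sub_sub, ← add_smul, ← add_div]
    rw [show 2 * lorentz x u + 2 * (lorentz x u - 2 * lorentz x u) = 0 by ring]
    simp
  · rw [hf, show 2 * lorentz t u / lorentz u u = 1 by
      rw [div_eq_one_iff_eq hne, htu, huu]; ring]
    simp [hu]

/-- Two families with the same Gram matrix are related by a linear isometry. -/
theorem exists_linearIsometry_of_inner_eq {A E : Type*} [NormedAddCommGroup E]
    [InnerProductSpace ℝ E] [FiniteDimensional ℝ E] (f g : A → E)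
    (h : ∀ α β, inner ℝ (f α) (f β) = inner ℝ (g α) (g β)) :
    ∃ U : E →ₗᵢ[ℝ] E, ∀ α, U (f α) = g α := by
  classical
  set F := Finsupp.linearCombination ℝ f
  set G := Finsupp.linearCombination ℝ g
  have hFG : ∀ c, ‖F c‖ = ‖G c‖ := by
    intro c
    rw [← sq_eq_sq₀ (norm_nonneg _) (norm_nonneg _), ← real_inner_self_eq_norm_sq,
      ← real_inner_self_eq_norm_sq]
    simp only [F, G, Finsupp.linearCombination_apply, Finsupp.sum, sum_inner, inner_sum,
      real_inner_smul_left, real_inner_smul_right, h]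
  obtain ⟨s, hs⟩ := F.rangeRestrict.exists_rightInverse_of_surjective F.range_rangeRestrict
  have hs' : ∀ x, F (s x) = x := fun x => congrArg Subtype.val (LinearMap.congr_fun hs x)
  let L : LinearMap.range F →ₗᵢ[ℝ] E :=
    ⟨G ∘ₗ s, fun x => by rw [LinearMap.comp_apply, ← hFG, hs']; rfl⟩
  refine ⟨L.extend, fun α => ?_⟩
  have hF : F (Finsupp.single α 1) = f α := by simp [F]
  have hG : G (Finsupp.single α 1) = g α := by simp [G]
  have hx : f α ∈ LinearMap.range F := ⟨_, hF⟩
  rw [show f α = ((⟨f α, hx⟩ : LinearMap.range F) : E) from rfl, L.extend_apply]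
  change G (s ⟨f α, hx⟩) = g α
  rw [← hG, ← sub_eq_zero, ← map_sub, ← norm_eq_zero, ← hFG, map_sub, hs', hF, sub_self,
    norm_zero]

/-- Families with equal Lorentz Gram matrices are related by a Lorentz-product preserving map,
provided that the time axis is spanned by the sum of the same two members of each. -/
theorem exists_lorentz_of_gram_of_axis {A : Type*} (w w' : A → Fin (N + 1) → ℝ)
    (h : ∀ α β, lorentz (w α) (w β) = lorentz (w' α) (w' β)) {a b : A} {c : ℝ} (hc : 0 < c)
    (hw : w a + w b = c • Pi.single (Fin.last N) 1)
    (hw' : w' a + w' b = c • Pi.single (Fin.last N) 1) :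
    ∃ f : (Fin (N + 1) → ℝ) →ₗ[ℝ] (Fin (N + 1) → ℝ),
      (∀ x y, lorentz (f x) (f y) = lorentz x y) ∧ ∀ α, f (w α) = w' α := by
  have htime : ∀ α, w α (Fin.last N) = w' α (Fin.last N) := by
    intro α
    have h1 : lorentz (w α) (w a + w b) = lorentz (w' α) (w' a + w' b) := by
      rw [lorentz_add_right, lorentz_add_right, h, h]
    rw [hw, hw', lorentz_smul_right, lorentz_smul_right, lorentz_single_last,
      lorentz_single_last] at h1
    exact neg_injective (mul_left_cancel₀ hc.ne' h1)
  have hinner : ∀ x y : EuclideanSpace ℝ (Fin (N + 1)), inner ℝ x y =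
      lorentz x.ofLp y.ofLp + 2 * (x (Fin.last N) * y (Fin.last N)) := by
    intro x y
    rw [← sum_mul_eq_lorentz, PiLp.inner_apply]
    simp [mul_comm]
  obtain ⟨U, hU⟩ := exists_linearIsometry_of_inner_eq
    (fun α => (WithLp.toLp 2 (w α) : EuclideanSpace ℝ (Fin (N + 1))))
    (fun α => WithLp.toLp 2 (w' α)) (by
      intro α β
      rw [hinner, hinner]
      simp only [h, htime])
  let e : EuclideanSpace ℝ (Fin (N + 1)) := WithLp.toLp 2 (Pi.single (Fin.last N) 1)
  have hUe : U e = e := by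
    have h1 : U (c • e) = c • e := by
      have h2 : c • e = WithLp.toLp 2 (w a) + WithLp.toLp 2 (w b) := by
        rw [← WithLp.toLp_add, hw, WithLp.toLp_smul]
      have h3 : c • e = WithLp.toLp 2 (w' a) + WithLp.toLp 2 (w' b) := by
        rw [← WithLp.toLp_add, hw', WithLp.toLp_smul]
      conv_lhs => rw [h2]
      rw [map_add, hU, hU, h3]
    rw [map_smul] at h1
    exact smul_right_injective _ hc.ne' h1
  have hlast : ∀ x : EuclideanSpace ℝ (Fin (N + 1)), U x (Fin.last N) = x (Fin.last N) := by
    have h1 : ∀ x : EuclideanSpace ℝ (Fin (N + 1)), inner ℝ x e = x (Fin.last N) := by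
      intro x
      rw [hinner, lorentz_single_last]
      simp [e]
      ring
    intro x
    rw [← h1, ← h1 x, ← U.inner_map_map x e, hUe]
  refine ⟨(WithLp.linearEquiv 2 ℝ (Fin (N + 1) → ℝ)).toLinearMap ∘ₗ U.toLinearMap ∘ₗ
    (WithLp.linearEquiv 2 ℝ (Fin (N + 1) → ℝ)).symm.toLinearMap, fun x y => ?_, fun α => ?_⟩
  · have h1 := U.inner_map_map (WithLp.toLp 2 x) (WithLp.toLp 2 y)
    rw [hinner, hinner, hlast, hlast] at h1
    exact add_right_cancel h1
  · exact congrArg WithLp.ofLp (hU α)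

/-- Families with equal Lorentz Gram matrices containing two positive light-like vectors with
negative product are related by a positive Lorentz transformation. -/
theorem exists_positiveLorentz_of_gram {A : Type*} (w w' : A → Fin (N + 1) → ℝ)
    (h : ∀ α β, lorentz (w α) (w β) = lorentz (w' α) (w' β))
    (hp : ∀ α, 0 < w α (Fin.last N)) (hp' : ∀ α, 0 < w' α (Fin.last N)) {a b : A}
    (ha : lorentz (w a) (w a) = 0) (hb : lorentz (w b) (w b) = 0)
    (hab : lorentz (w a) (w b) < 0) :
    ∃ φ : (Fin (N + 1) → ℝ) ≃ₗ[ℝ] (Fin (N + 1) → ℝ), IsLorentz φ ∧ IsPositiveLorentz φ ∧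
      ∀ α, φ (w α) = w' α := by
  have ht : lorentz (w a + w b) (w a + w b) < 0 := by
    simp only [lorentz_add_left, lorentz_add_right, ha, hb, lorentz_comm (w b) (w a)]
    linarith
  have ht' : lorentz (w' a + w' b) (w' a + w' b) = lorentz (w a + w b) (w a + w b) := by
    simp only [lorentz_add_left, lorentz_add_right, h]
  have ht0 : 0 < (w a + w b) (Fin.last N) := add_pos (hp a) (hp b)
  set c := √(-lorentz (w a + w b) (w a + w b)) with hc
  have hc0 : 0 < c := Real.sqrt_pos.2 (by linarith)
  have hcc : lorentz (w a + w b) (w a + w b) = -c ^ 2 := by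
    rw [hc, Real.sq_sqrt (by linarith), neg_neg]
  obtain ⟨f, hf, -, hft⟩ := exists_lorentz_involution hc0 hcc
  obtain ⟨f', hf', hff', hft'⟩ := exists_lorentz_involution hc0 (ht'.trans hcc)
  obtain ⟨g, hg, hgw⟩ := exists_lorentz_of_gram_of_axis (fun α => f (w α)) (fun α => f' (w' α))
    (fun α β => by rw [hf, hf', h]) hc0 (by rw [← map_add, hft]) (by rw [← map_add, hft'])
  obtain ⟨φ, hφ, hφf⟩ := exists_linearEquiv_of_lorentz (f' ∘ₗ g ∘ₗ f)
    (fun x y => by simp only [LinearMap.comp_apply, hf, hg, hf'])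
  have hφw : ∀ α, φ (w α) = w' α := by
    intro α
    rw [hφf, LinearMap.comp_apply, LinearMap.comp_apply, hgw, hff']
  exact ⟨φ, hφ, hφ.isPositive ht ht0 (by
    rw [map_add, hφw, hφw]
    exact add_pos (hp' a) (hp' b)), hφw⟩

end LorentzMaps

/-- A positive symmetric off-diagonal array with trivial cross-ratios has rank one. -/
theorem exists_mul_eq_of_cross {A : Type*} [Nontrivial A] (r : A → A → ℝ)
    (hsymm : ∀ α β, r α β = r β α) (hpos : ∀ α β, α ≠ β → 0 < r α β)
    (hcross : ∀ α β γ δ : A, α ≠ β → α ≠ γ → α ≠ δ → β ≠ γ → β ≠ δ → γ ≠ δ →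
      r α β * r γ δ = r α γ * r β δ) :
    ∃ s : A → ℝ, (∀ α, 0 < s α) ∧ ∀ α β, α ≠ β → s α * s β = r α β := by
  classical
  obtain ⟨a, b, hab⟩ := exists_pair_ne A
  obtain ⟨q, hq, hqr⟩ : ∃ q : ℝ, 0 < q ∧
      ∀ x y, x ≠ a → y ≠ a → x ≠ y → r a x * r a y = q ^ 2 * r x y := by
    by_cases h3 : ∃ c, c ≠ a ∧ c ≠ b
    · obtain ⟨c, hca, hcb⟩ := h3
      have hab0 := hpos a b hab
      have hac0 := hpos a c hca.symm
      have hbc0 := hpos b c hcb.symm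
      refine ⟨√(r a b * r a c / r b c), by positivity, fun x y hx hy hxy => ?_⟩
      rw [Real.sq_sqrt (by positivity), div_mul_eq_mul_div, eq_div_iff hbc0.ne']
      have key : ∀ x y, x ≠ a → y ≠ a → x ≠ y → y ≠ b → y ≠ c →
          r a x * r a y * r b c = r a b * r a c * r x y := by
        intro x y hx hy hxy hyb hyc
        have h1 : r a y * r b c = r a c * r b y := by
          rw [hsymm b c, hsymm b y]
          exact hcross a y c b hy.symm hca.symm hab hyc hyb hcb
        by_cases hxb : x = b
        · subst hxb
          linear_combination r a x * h1
        · have h2 := hcross a x b y hx.symm hab hy.symm hxb hxy hyb.symm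
          linear_combination r a x * h1 + r a c * h2
      by_cases hyb : y = b
      · subst hyb
        by_cases hxc : x = c
        · subst hxc
          rw [hsymm x y]; ring
        · have := key y x hab.symm hx hxy.symm hxy hxc
          rw [hsymm x y]; linarith
      · by_cases hyc : y = c
        · subst hyc
          by_cases hxb : x = b
          · subst hxb; ring
          · have := key y x hy hx hxy.symm hxb hxy
            rw [hsymm x y]; linarith
        · exact key x y hx hy hxy hyb hyc
    · push Not at h3
      exact ⟨1, one_pos, fun x y hx hy hxy => absurd ((h3 x hx).trans (h3 y hy).symm) hxy⟩
  refine ⟨fun x => if x = a then q else r a x / q, fun x => ?_, fun x y hxy => ?_⟩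
  · dsimp only
    split_ifs with hx
    · exact hq
    · exact div_pos (hpos a x (Ne.symm hx)) hq
  · by_cases hx : x = a
    · subst hx
      simp only [if_true, if_neg hxy.symm]
      field_simp
    · by_cases hy : y = a
      · subst hy
        simp only [if_true, if_neg hxy, hsymm x y]
        field_simp
      · simp only [if_neg hx, if_neg hy]
        rw [div_mul_div_comm, hqr x y hx hy hxy]
        field_simp

/-- Two families of at least two positive light-like vectors with equal cross-ratios are related,
up to positive factors, by a positive Lorentz transformation. -/
theorem exists_positiveLorentz_of_crossRatio {N : ℕ} {A : Type*} [Nontrivial A]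
    (v v' : A → Fin (N + 1) → ℝ)
    (hl : ∀ α : A, lorentz (v α) (v α) = 0) (hl' : ∀ α : A, lorentz (v' α) (v' α) = 0)
    (hp : ∀ α : A, 0 < v α (Fin.last N)) (hp' : ∀ α : A, 0 < v' α (Fin.last N))
    (hn : ∀ α β : A, α ≠ β → lorentz (v α) (v β) < 0)
    (hn' : ∀ α β : A, α ≠ β → lorentz (v' α) (v' β) < 0)
    (hcross : ∀ α β γ δ : A, α ≠ β → α ≠ γ → α ≠ δ → β ≠ γ → β ≠ δ → γ ≠ δ →
      (lorentz (v α) (v β) * lorentz (v γ) (v δ)) /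
        (lorentz (v α) (v γ) * lorentz (v β) (v δ)) =
      (lorentz (v' α) (v' β) * lorentz (v' γ) (v' δ)) /
        (lorentz (v' α) (v' γ) * lorentz (v' β) (v' δ))) :
    ∃ φ : (Fin (N + 1) → ℝ) ≃ₗ[ℝ] (Fin (N + 1) → ℝ), IsLorentz φ ∧ IsPositiveLorentz φ ∧
      ∀ α : A, ∃ s : ℝ, 0 < s ∧ φ (s • v α) = v' α := by
  obtain ⟨s, hs, hsr⟩ := exists_mul_eq_of_cross
    (fun α β => lorentz (v' α) (v' β) / lorentz (v α) (v β))
    (fun α β => by rw [lorentz_comm (v' α), lorentz_comm (v α)])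
    (fun α β h => div_pos_of_neg_of_neg (hn' α β h) (hn α β h)) (by
      intro α β γ δ h1 h2 h3 h4 h5 h6
      have := hcross α β γ δ h1 h2 h3 h4 h5 h6
      have e1 := (hn α β h1).ne
      have e2 := (hn γ δ h6).ne
      have e3 := (hn α γ h2).ne
      have e4 := (hn β δ h5).ne
      have e3' := (hn' α γ h2).ne
      have e4' := (hn' β δ h5).ne
      rw [div_eq_div_iff (mul_ne_zero e3 e4) (mul_ne_zero e3' e4')] at this
      rw [div_mul_div_comm, div_mul_div_comm,
        div_eq_div_iff (mul_ne_zero e1 e2) (mul_ne_zero e3 e4)]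
      linear_combination -this)
  obtain ⟨a, b, hab⟩ := exists_pair_ne A
  obtain ⟨φ, hφ, hφp, hφv⟩ := exists_positiveLorentz_of_gram (fun α => s α • v α) v'
    (fun α β => by
      rw [lorentz_smul_left, lorentz_smul_right]
      by_cases h : α = β
      · subst h
        simp [hl, hl']
      · rw [← mul_assoc, hsr α β h, div_mul_cancel₀ _ (hn α β h).ne])
    (fun α => mul_pos (hs α) (hp α)) hp' (a := a) (b := b)
    (by simp [lorentz_smul_left, lorentz_smul_right, hl])
    (by simp [lorentz_smul_left, lorentz_smul_right, hl])
    (by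
      rw [lorentz_smul_left, lorentz_smul_right, ← mul_assoc]
      exact mul_neg_of_pos_of_neg (mul_pos (hs a) (hs b)) (hn a b hab))
  exact ⟨φ, hφ, hφp, fun α => ⟨s α, hs α, hφv α⟩⟩

/-- Every positive light-like vector has a companion on another light-like line. -/
theorem exists_lightlike_companion {N : ℕ} {x : Fin (N + 1) → ℝ} (hx : lorentz x x = 0)
    (hx0 : 0 < x (Fin.last N)) :
    ∃ y : Fin (N + 1) → ℝ, lorentz y y = 0 ∧ 0 < y (Fin.last N) ∧ lorentz x y < 0 := by
  have he : lorentz (Pi.single (Fin.last N) 1) (Pi.single (Fin.last N) 1 : Fin (N + 1) → ℝ) =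
      -1 := by
    rw [lorentz_single_last]; simp
  have hxe := lorentz_single_last x
  refine ⟨(2 * x (Fin.last N)) • Pi.single (Fin.last N) 1 - x, ?_, ?_, ?_⟩
  · simp only [lorentz_sub_left, lorentz_sub_right, lorentz_smul_left, lorentz_smul_right, he,
      lorentz_comm (Pi.single (Fin.last N) 1) x, hxe, hx]
    ring
  · simp only [Pi.sub_apply, Pi.smul_apply, Pi.single_eq_same, smul_eq_mul]
    linarith
  · rw [lorentz_sub_right, lorentz_smul_right, hxe, hx]
    nlinarith

/-- Two families of pairwise-distinct light-like lines, given by positive light-like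
representatives v_α and v'_α, are matched by a positive Lorentz transformation if and
only if all their Lorentz cross-ratios agree. -/
theorem stmt_16 {N : ℕ} {A : Type*} (v v' : A → Fin (N + 1) → ℝ)
    (hl : ∀ α : A, lorentz (v α) (v α) = 0) (hl' : ∀ α : A, lorentz (v' α) (v' α) = 0)
    (hp : ∀ α : A, 0 < v α (Fin.last N)) (hp' : ∀ α : A, 0 < v' α (Fin.last N))
    (hd : ∀ α β : A, α ≠ β →
      Submodule.span ℝ {v α} ≠ Submodule.span ℝ {v β})
    (hd' : ∀ α β : A, α ≠ β →
      Submodule.span ℝ {v' α} ≠ Submodule.span ℝ {v' β}) :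
    (∃ φ : (Fin (N + 1) → ℝ) ≃ₗ[ℝ] (Fin (N + 1) → ℝ), IsLorentz φ ∧ IsPositiveLorentz φ ∧
      ∀ α : A, Submodule.map (φ : (Fin (N + 1) → ℝ) →ₗ[ℝ] (Fin (N + 1) → ℝ))
        (Submodule.span ℝ {v α}) = Submodule.span ℝ {v' α}) ↔
    (∀ α β γ δ : A, α ≠ β → α ≠ γ → α ≠ δ → β ≠ γ → β ≠ δ → γ ≠ δ →
      (lorentz (v α) (v β) * lorentz (v γ) (v δ)) /
        (lorentz (v α) (v γ) * lorentz (v β) (v δ)) =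
      (lorentz (v' α) (v' β) * lorentz (v' γ) (v' δ)) /
        (lorentz (v' α) (v' γ) * lorentz (v' β) (v' δ))) := by
  constructor
  · rintro ⟨φ, hφ, -, hφv⟩ α β γ δ - - - - - -
    have key : ∀ α, ∃ m : ℝ, m ≠ 0 ∧ φ (v α) = m • v' α := by
      intro α
      have hmem : φ (v α) ∈ Submodule.span ℝ {v' α} := by
        rw [← hφv α]
        exact Submodule.mem_map_of_mem (Submodule.mem_span_singleton_self _)
      obtain ⟨m, hm⟩ := Submodule.mem_span_singleton.1 hmem
      refine ⟨m, ?_, hm.symm⟩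
      rintro rfl
      rw [zero_smul, eq_comm, LinearEquiv.map_eq_zero_iff] at hm
      exact (hp α).ne' (congrFun hm _)
    choose m hm0 hm using key
    have hlor : ∀ α β, lorentz (v α) (v β) = m α * m β * lorentz (v' α) (v' β) := by
      intro α β
      rw [← hφ, hm, hm, lorentz_smul_left, lorentz_smul_right, mul_assoc]
    have hne : m α * m β * m γ * m δ ≠ 0 := by simp [hm0]
    rw [← mul_div_mul_left (lorentz (v' α) (v' β) * lorentz (v' γ) (v' δ)) _ hne]
    simp only [hlor]
    congr 1 <;> ring
  · intro hcross
    suffices h : ∃ φ : (Fin (N + 1) → ℝ) ≃ₗ[ℝ] (Fin (N + 1) → ℝ), IsLorentz φ ∧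
        IsPositiveLorentz φ ∧ ∀ α : A, ∃ s : ℝ, 0 < s ∧ φ (s • v α) = v' α by
      obtain ⟨φ, hφ, hφp, hφv⟩ := h
      refine ⟨φ, hφ, hφp, fun α => ?_⟩
      obtain ⟨s, hs, hsv⟩ := hφv α
      rw [← Submodule.span_singleton_smul_eq (IsUnit.mk0 s hs.ne') (v α), Submodule.map_span,
        Set.image_singleton, LinearEquiv.coe_coe, hsv]
    rcases subsingleton_or_nontrivial A with hA | hA
    · rcases isEmpty_or_nonempty A with hE | ⟨⟨a⟩⟩
      · exact ⟨LinearEquiv.refl ℝ _, fun _ _ => rfl, fun _ _ h => h, fun α => isEmptyElim α⟩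
      obtain ⟨y, hy, hy0, hay⟩ := exists_lightlike_companion (hl a) (hp a)
      obtain ⟨y', hy', hy0', hay'⟩ := exists_lightlike_companion (hl' a) (hp' a)
      obtain ⟨φ, hφ, hφp, hφv⟩ := exists_positiveLorentz_of_crossRatio
        (fun i : Bool => if i then v a else y) (fun i : Bool => if i then v' a else y')
        (by simp [hl, hy]) (by simp [hl', hy']) (by simp [hp, hy0]) (by simp [hp', hy0'])
        (by simp [hay, lorentz_comm y]) (by simp [hay', lorentz_comm y'])
        (fun α β γ _ h1 h2 _ h4 => by
          cases α <;> cases β <;> cases γ <;> simp_all)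
      refine ⟨φ, hφ, hφp, fun α => ?_⟩
      rw [Subsingleton.elim α a]
      simpa using hφv true
    · exact exists_positiveLorentz_of_crossRatio v v' hl hl' hp hp'
        (fun α β h => lorentz_neg_of_lightlike (hl α) (hl β) (hp α) (hp β) (hd α β h))
        (fun α β h => lorentz_neg_of_lightlike (hl' α) (hl' β) (hp' α) (hp' β) (hd' α β h))
        hcross
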